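/- arXiv:2404.01505 — 4 statements merged into one kernel-verified Lean document; each statement's English description precedes it below -/
import Mathlib

section
/- Let Q be a real orthogonal 3×3 matrix, let u : ℝ³ → ℝ³ be continuously differentiable with curl ω = ∇×u, where ω is continuous, integrable and bounded, and suppose u has the Biot-Savart representation u(x) = −(1/(4π)) ∫_{ℝ³} ((x−y)/|x−y|³) × ω(y) dy for every x ∈ ℝ³. Then u^Q = u if and only if ω = det(Q) · ω^Q. -/
open Matrix MeasureTheory Real

noncomputable section

abbrev V3 := Fin 3 → ℝ

/-- The Euclidean norm on `ℝ³`. -/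
def enorm3 (x : V3) : ℝ := Real.sqrt (∑ i, x i ^ 2)

/-- The transformed vector field `u^Q(x) = Q u(Qᵀ x)`. -/
def transform (Q : Matrix (Fin 3) (Fin 3) ℝ) (u : V3 → V3) : V3 → V3 :=
  fun x => Q.mulVec (u (Qᵀ.mulVec x))

/-- The partial derivative `∂_i f` at `x`. -/
def pd (i : Fin 3) (f : V3 → ℝ) (x : V3) : ℝ := fderiv ℝ f x (Pi.single i 1)

/-- The curl `∇×u = (∂₂u₃ − ∂₃u₂, ∂₃u₁ − ∂₁u₃, ∂₁u₂ − ∂₂u₁)`. -/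
def curl (u : V3 → V3) (x : V3) : V3 :=
  ![pd 1 (fun y => u y 2) x - pd 2 (fun y => u y 1) x,
    pd 2 (fun y => u y 0) x - pd 0 (fun y => u y 2) x,
    pd 0 (fun y => u y 1) x - pd 1 (fun y => u y 0) x]

/-- The Biot-Savart kernel `((x−y)/|x−y|³) × ω(y)`. -/
def bsKernel (ω : V3 → V3) (x y : V3) : V3 :=
  crossProduct ((enorm3 (x - y) ^ 3)⁻¹ • (x - y)) (ω y)

/-- `u` has the Biot-Savart representation from `ω`:
`u(x) = −(1/(4π)) ∫ ((x−y)/|x−y|³) × ω(y) dy`, the integral converging absolutely. -/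
def BiotSavartRep (u ω : V3 → V3) : Prop :=
  ∀ x, Integrable (bsKernel ω x) ∧ u x = (-(4 * π)⁻¹) • ∫ y : V3, bsKernel ω x y

/-- A matrix `M` intertwines cross products up to its determinant and transpose. -/
theorem transpose_mulVec_crossProduct (M : Matrix (Fin 3) (Fin 3) ℝ) (a b : V3) :
    Mᵀ.mulVec (crossProduct (M.mulVec a) (M.mulVec b)) = M.det • crossProduct a b := by
  ext i
  fin_cases i <;>
    simp [Matrix.mulVec, dotProduct, Fin.sum_univ_three, cross_apply, Matrix.det_fin_three] <;>
    ring

theorem mulVec_crossProduct_of_orthogonal {Q : Matrix (Fin 3) (Fin 3) ℝ} (hQ : Qᵀ * Q = 1)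
    (a b : V3) :
    crossProduct (Q.mulVec a) (Q.mulVec b) = Q.det • Q.mulVec (crossProduct a b) := by
  rw [← Matrix.mulVec_smul, ← transpose_mulVec_crossProduct, Matrix.mulVec_mulVec,
    mul_eq_one_comm.mp hQ, Matrix.one_mulVec]

theorem det_mul_self_of_orthogonal {Q : Matrix (Fin 3) (Fin 3) ℝ} (hQ : Qᵀ * Q = 1) :
    Q.det * Q.det = 1 := by
  simpa using congrArg Matrix.det hQ

theorem enorm3_mulVec_of_orthogonal {Q : Matrix (Fin 3) (Fin 3) ℝ} (hQ : Qᵀ * Q = 1) (a : V3) :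
    enorm3 (Q.mulVec a) = enorm3 a := by
  have h : Q.mulVec a ⬝ᵥ Q.mulVec a = a ⬝ᵥ a := by
    rw [Matrix.dotProduct_mulVec, Matrix.vecMul_mulVec, ← Matrix.dotProduct_mulVec, hQ,
      Matrix.one_mulVec]
  simp only [dotProduct, ← pow_two] at h
  simp only [enorm3, h]

theorem transpose_orthogonal {Q : Matrix (Fin 3) (Fin 3) ℝ} (hQ : Qᵀ * Q = 1) :
    Qᵀᵀ * Qᵀ = 1 := by
  rw [Matrix.transpose_transpose, mul_eq_one_comm.mp hQ]

/-- Orthogonal matrices preserve Lebesgue measure. -/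
theorem measurePreserving_mulVec_of_orthogonal {Q : Matrix (Fin 3) (Fin 3) ℝ}
    (hQ : Qᵀ * Q = 1) : MeasurePreserving (fun x : V3 => Q.mulVec x) := by
  have hd := det_mul_self_of_orthogonal hQ
  refine ⟨by fun_prop, ?_⟩
  have h := Real.map_matrix_volume_pi_eq_smul_volume_pi (M := Q) (left_ne_zero_of_mul_eq_one hd)
  have habs : |Q.det⁻¹| = 1 := by
    rw [inv_eq_of_mul_eq_one_right hd]
    rcases mul_self_eq_one_iff.mp hd with h | h <;> simp [h]
  rw [habs, ENNReal.ofReal_one, one_smul] at h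
  exact h

theorem bsKernel_transform {Q : Matrix (Fin 3) (Fin 3) ℝ} (hQ : Qᵀ * Q = 1)
    (ω : V3 → V3) (x y : V3) :
    bsKernel (Q.det • transform Q ω) x y =
      Q.mulVec (bsKernel ω (Qᵀ.mulVec x) (Qᵀ.mulVec y)) := by
  have hxy : Q.mulVec (Qᵀ.mulVec (x - y)) = x - y := by
    rw [Matrix.mulVec_mulVec, mul_eq_one_comm.mp hQ, Matrix.one_mulVec]
  have h := mulVec_crossProduct_of_orthogonal hQ (Qᵀ.mulVec (x - y)) (ω (Qᵀ.mulVec y))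
  rw [hxy] at h
  simp only [bsKernel, transform, Pi.smul_apply, ← Matrix.mulVec_sub,
    enorm3_mulVec_of_orthogonal (transpose_orthogonal hQ), map_smul, LinearMap.smul_apply, h,
    Matrix.mulVec_smul]
  rw [smul_smul, smul_smul, mul_right_comm, det_mul_self_of_orthogonal hQ, one_mul]

/-- The Biot-Savart integral is equivariant under orthogonal transformations. -/
theorem integral_bsKernel_transform {Q : Matrix (Fin 3) (Fin 3) ℝ} (hQ : Qᵀ * Q = 1)
    (ω : V3 → V3) (x : V3) (hi : Integrable (bsKernel ω (Qᵀ.mulVec x))) :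
    ∫ y, bsKernel (Q.det • transform Q ω) x y =
      Q.mulVec (∫ y, bsKernel ω (Qᵀ.mulVec x) y) := by
  have hmp := measurePreserving_mulVec_of_orthogonal (transpose_orthogonal hQ)
  let L : V3 →L[ℝ] V3 := (Matrix.toLin' Q).toContinuousLinearMap
  have hL : ∫ y, L (bsKernel ω (Qᵀ.mulVec x) y) = L (∫ y, bsKernel ω (Qᵀ.mulVec x) y) :=
    L.integral_comp_comm hi
  have hmap := integral_map hmp.measurable.aemeasurable
    (hmp.map_eq.symm ▸ (L.integrable_comp hi).aestronglyMeasurable)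
  rw [hmp.map_eq] at hmap
  simp only [bsKernel_transform hQ]
  exact hmap.symm.trans hL

theorem curl_eq_of_hasFDerivAt {u : V3 → V3} {L : V3 →L[ℝ] V3} {x : V3}
    (h : HasFDerivAt u L x) :
    curl u x = ![L (Pi.single 1 1) 2 - L (Pi.single 2 1) 1,
      L (Pi.single 2 1) 0 - L (Pi.single 0 1) 2,
      L (Pi.single 0 1) 1 - L (Pi.single 1 1) 0] := by
  have hpd (i j : Fin 3) : pd i (fun y => u y j) x = L (Pi.single i 1) j := by
    rw [pd, (hasFDerivAt_pi'.mp h j).fderiv]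
    rfl
  simp only [curl, hpd]

/-- The axial vector of `M A Mᵀ` in terms of that of `A`. -/
theorem transpose_mulVec_axial (M A : Matrix (Fin 3) (Fin 3) ℝ) :
    Mᵀ.mulVec ![(M * A * Mᵀ) 2 1 - (M * A * Mᵀ) 1 2, (M * A * Mᵀ) 0 2 - (M * A * Mᵀ) 2 0,
      (M * A * Mᵀ) 1 0 - (M * A * Mᵀ) 0 1] =
      M.det • ![A 2 1 - A 1 2, A 0 2 - A 2 0, A 1 0 - A 0 1] := by
  ext i
  fin_cases i <;>
    simp [Matrix.mulVec, dotProduct, Fin.sum_univ_three, Matrix.det_fin_three,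
      Matrix.mul_apply] <;>
    ring

theorem curl_transform {Q : Matrix (Fin 3) (Fin 3) ℝ} (hQ : Qᵀ * Q = 1) {u : V3 → V3} {x : V3}
    (hu : DifferentiableAt ℝ u (Qᵀ.mulVec x)) :
    curl (transform Q u) x = Q.det • transform Q (curl u) x := by
  let L : V3 →L[ℝ] V3 := (Matrix.toLin' Q).toContinuousLinearMap
  let L' : V3 →L[ℝ] V3 := (Matrix.toLin' Qᵀ).toContinuousLinearMap
  let D := fderiv ℝ u (Qᵀ.mulVec x)
  let A : Matrix (Fin 3) (Fin 3) ℝ := LinearMap.toMatrix' (D : V3 →ₗ[ℝ] V3)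
  have hu' : HasFDerivAt u D (L' x) := hu.hasFDerivAt
  have hT : HasFDerivAt (transform Q u) (L.comp (D.comp L')) x :=
    L.hasFDerivAt.comp x (hu'.comp x L'.hasFDerivAt)
  have hA (i j : Fin 3) : D (Pi.single j 1) i = A i j := by
    simp [A, LinearMap.toMatrix'_apply]
  have hQA (i j : Fin 3) : L.comp (D.comp L') (Pi.single j 1) i = (Q * A * Qᵀ) i j := by
    have hD (v : V3) : D v = A.mulVec v := by
      rw [← Matrix.toLin'_apply, Matrix.toLin'_toMatrix']
      rfl
    change (Q.mulVec (D (Qᵀ.mulVec (Pi.single j 1)))) i = _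
    rw [hD, Matrix.mulVec_mulVec, Matrix.mulVec_mulVec]
    simp
  rw [transform, curl_eq_of_hasFDerivAt hT, curl_eq_of_hasFDerivAt hu.hasFDerivAt]
  simp only [hQA]
  change _ = Q.det • Q.mulVec ![D _ _ - D _ _, D _ _ - D _ _, D _ _ - D _ _]
  simp only [hA]
  rw [← Matrix.mulVec_smul, ← transpose_mulVec_axial, Matrix.mulVec_mulVec,
    mul_eq_one_comm.mp hQ, Matrix.one_mulVec]

/-- For `Q` orthogonal and `u` a `C¹` vector field with continuous, integrable, bounded
curl `ω` having the Biot-Savart representation, `u^Q = u` if and only if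
`ω = det(Q) · ω^Q`. -/
theorem symmetric_iff_vorticity_symmetric
    (Q : Matrix (Fin 3) (Fin 3) ℝ) (hQ : Qᵀ * Q = 1)
    (u ω : V3 → V3) (hu : ContDiff ℝ 1 u)
    (hcurl : ∀ x, curl u x = ω x)
    (hωc : Continuous ω) (hωi : Integrable ω) (hωb : ∃ C, ∀ x, enorm3 (ω x) ≤ C)
    (hbs : BiotSavartRep u ω) :
    transform Q u = u ↔ ω = Q.det • transform Q ω := by
  have hω : curl u = ω := funext hcurl
  constructor
  · intro h
    funext x
    have hc := curl_transform hQ (x := x) ((hu.differentiable one_ne_zero) (Qᵀ.mulVec x))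
    rwa [h, hω] at hc
  · intro h
    funext x
    have hi := integral_bsKernel_transform hQ ω x (hbs (Qᵀ.mulVec x)).1
    rw [← h] at hi
    rw [transform, (hbs (Qᵀ.mulVec x)).2, (hbs x).2, hi, Matrix.mulVec_smul]

end
end

section
/- Let u : ℝ³ → ℝ³ be continuously differentiable with curl ω = ∇×u, where ω is continuous, integrable and bounded, and suppose u has the Biot-Savart representation u(x) = −(1/(4π)) ∫_{ℝ³} ((x−y)/|x−y|³) × ω(y) dy for every x ∈ ℝ³. Then u is permutation symmetric if and only if ω^{P₁₂} = −ω and ω^{P₁₃} = −ω. -/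
open Matrix MeasureTheory Real

noncomputable section

def P12 : Matrix (Fin 3) (Fin 3) ℝ := !![0,1,0;1,0,0;0,0,1]
def P13 : Matrix (Fin 3) (Fin 3) ℝ := !![0,0,1;0,1,0;1,0,0]
def P23 : Matrix (Fin 3) (Fin 3) ℝ := !![1,0,0;0,0,1;0,1,0]
def Pf : Matrix (Fin 3) (Fin 3) ℝ := !![0,0,1;1,0,0;0,1,0]
def Pb : Matrix (Fin 3) (Fin 3) ℝ := !![0,1,0;0,0,1;1,0,0]

/-- The group `𝒫₃` of six 3×3 permutation matrices. -/
def perms : Set (Matrix (Fin 3) (Fin 3) ℝ) := {1, P12, P13, P23, Pf, Pb}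

/-- `u` is permutation symmetric if `u^P = u` for every `P ∈ 𝒫₃`. -/
def PermSymmetric (u : V3 → V3) : Prop := ∀ P ∈ perms, transform P u = u

/-- Precomposition with a permutation of the coordinates, as a continuous linear map. -/
def permCoord (σ : Equiv.Perm (Fin 3)) : V3 →L[ℝ] V3 :=
  ContinuousLinearMap.pi fun i => ContinuousLinearMap.proj (σ i)

@[simp]
theorem permCoord_apply (σ : Equiv.Perm (Fin 3)) (x : V3) (i : Fin 3) :
    permCoord σ x i = x (σ i) := rfl

theorem transform_P12 (v : V3 → V3) (x : V3) :
    transform P12 v x = permCoord (Equiv.swap 0 1) (v (permCoord (Equiv.swap 0 1) x)) := by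
  have hP : ∀ z : V3, P12 *ᵥ z = permCoord (Equiv.swap 0 1) z := by
    intro z
    ext i
    fin_cases i <;> simp [P12, Matrix.mulVec, dotProduct, Fin.sum_univ_three]
    all_goals congr 1
  have hT : P12ᵀ = P12 := by
    ext i j
    fin_cases i <;> fin_cases j <;> rfl
  simp only [transform, hT, hP]

theorem transform_P13 (v : V3 → V3) (x : V3) :
    transform P13 v x = permCoord (Equiv.swap 0 2) (v (permCoord (Equiv.swap 0 2) x)) := by
  have hP : ∀ z : V3, P13 *ᵥ z = permCoord (Equiv.swap 0 2) z := by
    intro z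
    ext i
    fin_cases i <;> simp [P13, Matrix.mulVec, dotProduct, Fin.sum_univ_three]
    all_goals congr 1
  have hT : P13ᵀ = P13 := by
    ext i j
    fin_cases i <;> fin_cases j <;> rfl
  simp only [transform, hT, hP]

theorem transform_one (v : V3 → V3) : transform 1 v = v := by
  funext x
  simp [transform]

theorem transform_mul (A B : Matrix (Fin 3) (Fin 3) ℝ) (v : V3 → V3) :
    transform (A * B) v = transform A (transform B v) := by
  funext x
  simp [transform, Matrix.mulVec_mulVec, Matrix.transpose_mul]

theorem permSymmetric_iff (v : V3 → V3) :
    PermSymmetric v ↔ transform P12 v = v ∧ transform P13 v = v := by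
  constructor
  · intro h
    exact ⟨h _ (by simp [perms]), h _ (by simp [perms])⟩
  · rintro ⟨h12, h13⟩ P hP
    have e23 : P23 = P12 * (P13 * P12) := by
      ext i j
      fin_cases i <;> fin_cases j <;> simp [P23, P12, P13]
    have ef : Pf = P13 * P12 := by
      ext i j
      fin_cases i <;> fin_cases j <;> simp [Pf, P12, P13]
    have eb : Pb = P12 * P13 := by
      ext i j
      fin_cases i <;> fin_cases j <;> simp [Pb, P12, P13]
    simp only [perms, Set.mem_insert_iff, Set.mem_singleton_iff] at hP
    rcases hP with rfl | rfl | rfl | rfl | rfl | rfl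
    · exact transform_one v
    · exact h12
    · exact h13
    · simp only [e23, transform_mul, h12, h13]
    · simp only [ef, transform_mul, h12, h13]
    · simp only [eb, transform_mul, h12, h13]

theorem permCoord_single (σ : Equiv.Perm (Fin 3)) (j : Fin 3) :
    permCoord σ (Pi.single j 1) = Pi.single (σ.symm j) 1 := by
  ext i
  simp [Pi.single_apply, Equiv.eq_symm_apply]

theorem pd_of_permCoord_invariant {u : V3 → V3} (hu : Differentiable ℝ u)
    (σ : Equiv.Perm (Fin 3)) (h : ∀ x, permCoord σ (u (permCoord σ x)) = u x)
    (i j : Fin 3) (x : V3) :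
    pd j (fun y => u y i) x = pd (σ.symm j) (fun y => u y (σ i)) (permCoord σ x) := by
  have e : (fun y => u y i) = (fun y => u y (σ i)) ∘ permCoord σ := by
    funext y
    exact (congrFun (h y) i).symm
  have hd : Differentiable ℝ (fun y => u y (σ i)) := differentiable_pi.1 hu (σ i)
  rw [pd, e, fderiv_comp x (hd _) (permCoord σ).differentiableAt,
    ContinuousLinearMap.fderiv, ContinuousLinearMap.comp_apply, permCoord_single, pd]

/-- The curl of a field invariant under a transposition is anti-invariant. -/
theorem curl_of_swap_invariant {u : V3 → V3} (hu : Differentiable ℝ u) {a b : Fin 3}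
    (hab : a ≠ b)
    (h : ∀ x, permCoord (Equiv.swap a b) (u (permCoord (Equiv.swap a b) x)) = u x) (x : V3) :
    permCoord (Equiv.swap a b) (curl u (permCoord (Equiv.swap a b) x)) = -curl u x := by
  have hpd := fun i j => pd_of_permCoord_invariant hu (Equiv.swap a b) h i j x
  ext k
  rw [permCoord_apply, Pi.neg_apply]
  generalize hz : permCoord (Equiv.swap a b) x = z at hpd ⊢
  simp only [curl, hpd, Equiv.symm_swap]
  fin_cases a <;> fin_cases b <;> first | exact absurd rfl hab | skip
  all_goals fin_cases k <;> simp [Equiv.swap_apply_def]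

theorem integral_comp_permCoord (σ : Equiv.Perm (Fin 3)) (f : V3 → V3) :
    ∫ y, f (permCoord σ y) = ∫ y, f y := by
  have e : ∀ y : V3, permCoord σ y = MeasurableEquiv.piCongrLeft (fun _ => ℝ) σ.symm y := by
    intro y
    ext i
    obtain ⟨j, rfl⟩ := σ.symm.surjective i
    rw [MeasurableEquiv.coe_piCongrLeft, Equiv.piCongrLeft_apply_apply]
    simp
  simp only [e]
  exact (volume_measurePreserving_piCongrLeft (fun _ : Fin 3 => ℝ) σ.symm).integral_comp
    (MeasurableEquiv.measurableEmbedding _) f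

theorem enorm3_permCoord (σ : Equiv.Perm (Fin 3)) (x : V3) :
    enorm3 (permCoord σ x) = enorm3 x := by
  simp only [enorm3, permCoord_apply]
  rw [Equiv.sum_comp σ fun i => x i ^ 2]

theorem crossProduct_permCoord_swap {a b : Fin 3} (hab : a ≠ b) (v w : V3) :
    crossProduct (permCoord (Equiv.swap a b) v) (permCoord (Equiv.swap a b) w) =
      -permCoord (Equiv.swap a b) (crossProduct v w) := by
  ext k
  rw [Pi.neg_apply, permCoord_apply]
  simp only [cross_apply, permCoord_apply]
  fin_cases a <;> fin_cases b <;> first | exact absurd rfl hab | skip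
  all_goals fin_cases k <;> simp [Equiv.swap_apply_def]

/-- The Biot-Savart field of a vorticity anti-invariant under a transposition is invariant. -/
theorem BiotSavartRep.swap_invariant {u ω : V3 → V3} (hbs : BiotSavartRep u ω) {a b : Fin 3}
    (hab : a ≠ b)
    (h : ∀ x, permCoord (Equiv.swap a b) (ω (permCoord (Equiv.swap a b) x)) = -ω x) (x : V3) :
    permCoord (Equiv.swap a b) (u (permCoord (Equiv.swap a b) x)) = u x := by
  have hinv : ∀ z : V3, permCoord (Equiv.swap a b) (permCoord (Equiv.swap a b) z) = z := by
    intro z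
    ext i
    simp
  have hω : ∀ y, ω (permCoord (Equiv.swap a b) y) = permCoord (Equiv.swap a b) (-ω y) := by
    intro y
    rw [← h y, hinv]
  have hker : ∀ y, bsKernel ω (permCoord (Equiv.swap a b) x) (permCoord (Equiv.swap a b) y) =
      permCoord (Equiv.swap a b) (bsKernel ω x y) := by
    intro y
    rw [bsKernel, ← map_sub, enorm3_permCoord, ← map_smul, hω,
      crossProduct_permCoord_swap hab, bsKernel, map_neg, map_neg, neg_neg]
  rw [(hbs _).2, ← integral_comp_permCoord (Equiv.swap a b)]
  simp only [hker]
  rw [ContinuousLinearMap.integral_comp_comm _ (hbs x).1, map_smul, hinv, (hbs x).2]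

/-- A `C¹` vector field `u` with continuous, integrable, bounded curl `ω` having the
Biot-Savart representation is permutation symmetric if and only if
`ω^{P₁₂} = −ω` and `ω^{P₁₃} = −ω`. -/
theorem permSymmetric_iff_two_vorticity_conditions
    (u ω : V3 → V3) (hu : ContDiff ℝ 1 u)
    (hcurl : ∀ x, curl u x = ω x)
    (hωc : Continuous ω) (hωi : Integrable ω) (hωb : ∃ C, ∀ x, enorm3 (ω x) ≤ C)
    (hbs : BiotSavartRep u ω) :
    PermSymmetric u ↔ (transform P12 ω = -ω ∧ transform P13 ω = -ω) := by
  have hd : Differentiable ℝ u := hu.differentiable one_ne_zero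
  obtain rfl : curl u = ω := funext hcurl
  simp only [permSymmetric_iff, funext_iff (f := transform _ _), transform_P12, transform_P13,
    Pi.neg_apply]
  exact ⟨fun h => ⟨curl_of_swap_invariant hd (by decide) h.1,
      curl_of_swap_invariant hd (by decide) h.2⟩,
    fun h => ⟨hbs.swap_invariant (by decide) h.1, hbs.swap_invariant (by decide) h.2⟩⟩

end
end

section
/- Let ω = (ω₁, ω₂, ω₃) : ℝ³ → ℝ³ be integrable and bounded, and suppose ω₂(x) = −ω₁(P₁₂ x) and ω₃(x) = −ω₁(P₁₃ x) for almost every x. Then for every x ∈ ℝ³, the Biot-Savart integral can be written in terms of ω₁ alone: −(1/(4π)) ∫_{ℝ³} ((x−y)/|x−y|³) × ω(y) dy = (1/(4π)) ∫_{ℝ³} G(x,y) ω₁(y) dy, where G(x,y) = |x−y|^{−3} (0, −x₃+y₃, x₂−y₂) + |x−P₁₂y|^{−3} (−x₃+y₃, 0, x₁−y₂) + |x−P₁₃y|^{−3} (x₂−y₂, −x₁+y₃, 0). -/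
open Matrix MeasureTheory Real

noncomputable section

/-- The permutation-symmetric Biot-Savart kernel
`G(x,y) = |x−y|⁻³ (0, −x₃+y₃, x₂−y₂) + |x−P₁₂y|⁻³ (−x₃+y₃, 0, x₁−y₂)
  + |x−P₁₃y|⁻³ (x₂−y₂, −x₁+y₃, 0)`. -/
def G (x y : V3) : V3 :=
  (enorm3 (x - y) ^ 3)⁻¹ • ![0, -x 2 + y 2, x 1 - y 1] +
  (enorm3 (x - P12.mulVec y) ^ 3)⁻¹ • ![-x 2 + y 2, 0, x 0 - y 1] +
  (enorm3 (x - P13.mulVec y) ^ 3)⁻¹ • ![x 1 - y 1, -x 0 + y 2, 0]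

/-- Relabelling the coordinates of `ℝ³` preserves Lebesgue measure. -/
theorem measurePreserving_comp_perm (σ : Equiv.Perm (Fin 3)) :
    MeasurePreserving (fun y : V3 => y ∘ σ) :=
  (volume_measurePreserving_piCongrLeft (fun _ => ℝ) σ).symm

theorem P12_mulVec (y : V3) : P12.mulVec y = ![y 1, y 0, y 2] := by
  ext i; fin_cases i <;> simp [P12, mulVec, dotProduct, Fin.sum_univ_three]

theorem P13_mulVec (y : V3) : P13.mulVec y = ![y 2, y 1, y 0] := by
  ext i; fin_cases i <;> simp [P13, mulVec, dotProduct, Fin.sum_univ_three]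

theorem measurePreserving_P12 : MeasurePreserving (fun y : V3 => P12.mulVec y) := by
  convert measurePreserving_comp_perm (Equiv.swap 0 1) using 2 with y
  rw [P12_mulVec]
  ext i; fin_cases i <;> rfl

theorem measurePreserving_P13 : MeasurePreserving (fun y : V3 => P13.mulVec y) := by
  convert measurePreserving_comp_perm (Equiv.swap 0 2) using 2 with y
  rw [P13_mulVec]
  ext i; fin_cases i <;> rfl

theorem abs_apply_le_enorm3 (z : V3) (i : Fin 3) : |z i| ≤ enorm3 z :=
  abs_le_sqrt (Finset.single_le_sum (f := fun i => z i ^ 2) (fun _ _ => sq_nonneg _)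
    (Finset.mem_univ i))

theorem norm_le_enorm3 (z : V3) : ‖z‖ ≤ enorm3 z :=
  (pi_norm_le_iff_of_nonneg (Real.sqrt_nonneg _)).2 (abs_apply_le_enorm3 z)

/-- The vector kernel `z / |z|³`. -/
def rieszKernel (z : V3) : V3 := (enorm3 z ^ 3)⁻¹ • z

theorem measurable_rieszKernel : Measurable rieszKernel := by
  unfold rieszKernel enorm3
  fun_prop

theorem norm_rieszKernel_le (z : V3) : ‖rieszKernel z‖ ≤ ‖z‖ ^ (-2 : ℝ) := by
  rcases eq_or_ne z 0 with rfl | hz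
  · simp [rieszKernel]
  have hn : 0 < ‖z‖ := norm_pos_iff.2 hz
  have he : 0 < enorm3 z := hn.trans_le (norm_le_enorm3 z)
  have hp : ‖z‖ ^ (-2 : ℝ) = (‖z‖ ^ 3)⁻¹ * ‖z‖ := by
    rw [Real.rpow_neg hn.le, Real.rpow_ofNat]
    field_simp
  rw [rieszKernel, norm_smul, hp, norm_of_nonneg (by positivity)]
  gcongr
  exact norm_le_enorm3 z

theorem integrableOn_ball_rieszKernel : IntegrableOn rieszKernel (Metric.ball 0 1) := by
  refine integrableOn_ball_of_norm_le_rpow (C := 1) (α := 2) (by simp) (by simp; norm_num)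
    (.of_forall fun z => ?_) measurable_rieszKernel.aestronglyMeasurable
  simpa using norm_rieszKernel_le z

/-- The convolution of `z / |z|³` with a bounded integrable function converges absolutely. -/
theorem integrable_smul_rieszKernel {f : V3 → ℝ} (hf : Integrable f) {C : ℝ}
    (hC : ∀ y, |f y| ≤ C) (x : V3) : Integrable fun y => f y • rieszKernel (x - y) := by
  have hb : Integrable ((Metric.ball (0 : V3) 1).indicator fun z => ‖rieszKernel z‖) :=
    (integrable_indicator_iff measurableSet_ball).2 integrableOn_ball_rieszKernel.norm
  have hm : Measurable fun y : V3 => rieszKernel (x - y) :=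
    measurable_rieszKernel.comp (measurable_const.sub measurable_id)
  refine (((hb.comp_sub_left x).const_mul C).add hf.norm).mono'
    (hf.1.smul hm.aestronglyMeasurable) (.of_forall fun y => ?_)
  rw [norm_smul]
  by_cases hy : x - y ∈ Metric.ball (0 : V3) 1
  · simp only [Pi.add_apply, Set.indicator_of_mem hy]
    have := mul_le_mul_of_nonneg_right (hC y) (norm_nonneg (rieszKernel (x - y)))
    exact this.trans (le_add_of_nonneg_right (norm_nonneg _))
  · simp only [Pi.add_apply, Set.indicator_of_notMem hy, mul_zero, zero_add]
    have h1 : 1 ≤ ‖x - y‖ := by simpa using hy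
    exact mul_le_of_le_one_right (norm_nonneg _) ((norm_rieszKernel_le _).trans
      (rpow_le_one_of_one_le_of_nonpos h1 (by norm_num)))

/-- The contribution of the `j`-th component of `ω` to the Biot-Savart kernel. -/
def bsPart (ω : V3 → V3) (x : V3) (j : Fin 3) (y : V3) : V3 :=
  ω y j • crossProduct (rieszKernel (x - y)) (Pi.single j 1)

theorem integrable_bsPart {ω : V3 → V3} (hωi : Integrable ω) {C : ℝ}
    (hC : ∀ x, enorm3 (ω x) ≤ C) (x : V3) (j : Fin 3) : Integrable (bsPart ω x j) := by
  have h := integrable_smul_rieszKernel (hωi.eval j)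
    (fun y => (abs_apply_le_enorm3 (ω y) j).trans (hC y)) x
  refine ((crossProduct.flip (Pi.single j 1)).toContinuousLinearMap.integrable_comp h).congr
    (.of_forall fun y => ?_)
  simp [bsPart]

theorem bsKernel_eq_sum_bsPart (ω : V3 → V3) (x y : V3) :
    bsKernel ω x y = ∑ j, bsPart ω x j y := by
  simp only [bsKernel, bsPart, ← map_smul, ← map_sum]
  congr 1
  ext i
  simp [Finset.sum_apply, Pi.single_apply]

/-- If `ω` is integrable and bounded, with `ω₂(x) = −ω₁(P₁₂x)` and `ω₃(x) = −ω₁(P₁₃x)`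
a.e., then the Biot-Savart integral can be written in terms of `ω₁` alone:
`−(1/(4π)) ∫ ((x−y)/|x−y|³) × ω(y) dy = (1/(4π)) ∫ G(x,y) ω₁(y) dy`. -/
theorem biotSavart_one_component
    (ω : V3 → V3) (hωi : Integrable ω) (hωb : ∃ C, ∀ x, enorm3 (ω x) ≤ C)
    (h2 : ∀ᵐ x : V3, ω x 1 = -ω (P12.mulVec x) 0)
    (h3 : ∀ᵐ x : V3, ω x 2 = -ω (P13.mulVec x) 0)
    (x : V3) :
    (-(4 * π)⁻¹) • ∫ y : V3, bsKernel ω x y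
      = (4 * π)⁻¹ • ∫ y : V3, ω y 0 • G x y := by
  obtain ⟨C, hC⟩ := hωb
  have hI := integrable_bsPart hωi hC x
  have h12 : ∫ y, bsPart ω x 1 (P12.mulVec y) = ∫ y, bsPart ω x 1 y := by
    have h := integral_map measurePreserving_P12.aemeasurable
      (measurePreserving_P12.map_eq.symm ▸ (hI 1).1)
    rwa [measurePreserving_P12.map_eq, eq_comm] at h
  have h13 : ∫ y, bsPart ω x 2 (P13.mulVec y) = ∫ y, bsPart ω x 2 y := by
    have h := integral_map measurePreserving_P13.aemeasurable
      (measurePreserving_P13.map_eq.symm ▸ (hI 2).1)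
    rwa [measurePreserving_P13.map_eq, eq_comm] at h
  have hI12 : Integrable fun y => bsPart ω x 1 (P12.mulVec y) :=
    measurePreserving_P12.integrable_comp_of_integrable (hI 1)
  have hI13 : Integrable fun y => bsPart ω x 2 (P13.mulVec y) :=
    measurePreserving_P13.integrable_comp_of_integrable (hI 2)
  have hG : (fun y => ω y 0 • G x y) =ᵐ[volume] fun y =>
      -(bsPart ω x 0 y + bsPart ω x 1 (P12.mulVec y) + bsPart ω x 2 (P13.mulVec y)) := by
    filter_upwards [measurePreserving_P12.quasiMeasurePreserving.ae h2,
      measurePreserving_P13.quasiMeasurePreserving.ae h3] with y hy2 hy3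
    have e12 : P12.mulVec (P12.mulVec y) = y := by
      ext i; fin_cases i <;> simp [P12_mulVec]
    have e13 : P13.mulVec (P13.mulVec y) = y := by
      ext i; fin_cases i <;> simp [P13_mulVec]
    rw [e12] at hy2
    rw [e13] at hy3
    simp only [bsPart, hy2, hy3, G, rieszKernel]
    generalize (enorm3 (x - y) ^ 3)⁻¹ = a
    generalize (enorm3 (x - P12.mulVec y) ^ 3)⁻¹ = b
    generalize (enorm3 (x - P13.mulVec y) ^ 3)⁻¹ = c
    ext i
    fin_cases i <;> simp [cross_apply, P12_mulVec, P13_mulVec, vecHead, vecTail] <;> ring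
  have hI01 : Integrable fun y => bsPart ω x 0 y + bsPart ω x 1 (P12.mulVec y) := (hI 0).add hI12
  simp_rw [bsKernel_eq_sum_bsPart]
  rw [integral_congr_ae hG, integral_neg, integral_add hI01 hI13,
    integral_add (hI 0) hI12, h12, h13, integral_finsetSum _ fun j _ => hI j,
    Fin.sum_univ_three, neg_smul, smul_neg]

end
end

section
/- Let u : ℝ³ → ℝ³ be continuously differentiable, permutation symmetric, and divergence free (∂₁u₁ + ∂₂u₂ + ∂₃u₃ = 0). Then at every point x with x₁ = x₂ = x₃: all off-diagonal entries of the gradient agree, i.e. ∂_i u_j(x) = ∂₁ u₂(x) for all i ≠ j; all diagonal entries vanish, i.e. ∂_i u_i(x) = 0 for i = 1,2,3; and consequently the curl vanishes there, (∇×u)(x) = 0. -/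
open Matrix

noncomputable section

/-- The gradient of a field equivariant under a coordinate permutation `σ` is unchanged, at a
point fixed by `σ`, when both of its indices are permuted. -/
lemma pd_apply_perm {u : V3 → V3} {x : V3} (hu : DifferentiableAt ℝ u x)
    (σ : Equiv.Perm (Fin 3)) (hσ : ∀ y j, u y j = u (y ∘ σ) (σ.symm j)) (hx : x ∘ σ = x)
    (i j : Fin 3) :
    pd i (fun y => u y j) x = pd (σ.symm i) (fun y => u y (σ.symm j)) x := by
  let L : V3 →L[ℝ] V3 := (LinearMap.funLeft ℝ ℝ σ).toContinuousLinearMap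
  have hL : ∀ y, L y = y ∘ σ := fun _ => rfl
  have hd : DifferentiableAt ℝ (fun y => u y (σ.symm j)) (L x) := by
    rw [hL, hx]
    exact differentiableAt_pi.1 hu _
  have hcomp : (fun y => u y j) = (fun y => u y (σ.symm j)) ∘ L := by
    funext y
    exact hσ y j
  have hsingle : L (Pi.single i 1) = Pi.single (σ.symm i) 1 := by
    ext k
    simp [hL, Pi.single_apply, Equiv.eq_symm_apply]
  unfold pd
  rw [hcomp, fderiv_comp x hd L.differentiableAt, L.fderiv, ContinuousLinearMap.comp_apply,
    hsingle, hL, hx]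

lemma PermSymmetric.swap_zero_one {u : V3 → V3} (h : PermSymmetric u) (y : V3) (j : Fin 3) :
    u y j = u (y ∘ Equiv.swap 0 1) ((Equiv.swap 0 1).symm j) := by
  have hy : P12ᵀ *ᵥ y = y ∘ Equiv.swap 0 1 := by
    ext k
    fin_cases k <;> simp [P12, Matrix.mulVec, dotProduct, Fin.sum_univ_three,
      Equiv.swap_apply_def]
  conv_lhs => rw [← h P12 (by simp [perms]), transform, hy]
  fin_cases j <;> simp [P12, Matrix.mulVec, dotProduct, Fin.sum_univ_three,
    Equiv.swap_apply_def]

lemma PermSymmetric.swap_one_two {u : V3 → V3} (h : PermSymmetric u) (y : V3) (j : Fin 3) :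
    u y j = u (y ∘ Equiv.swap 1 2) ((Equiv.swap 1 2).symm j) := by
  have hy : P23ᵀ *ᵥ y = y ∘ Equiv.swap 1 2 := by
    ext k
    fin_cases k <;> simp [P23, Matrix.mulVec, dotProduct, Fin.sum_univ_three,
      Equiv.swap_apply_def]
  conv_lhs => rw [← h P23 (by simp [perms]), transform, hy]
  fin_cases j <;> simp [P23, Matrix.mulVec, dotProduct, Fin.sum_univ_three,
    Equiv.swap_apply_def]

/-- For a `C¹`, permutation symmetric, divergence free vector field `u`, at every
point of the axis `x₁ = x₂ = x₃` all off-diagonal entries of the gradient agree,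
all diagonal entries vanish, and the curl vanishes. -/
theorem gradient_structure_on_diagonal_axis
    (u : V3 → V3) (hu : ContDiff ℝ 1 u) (hperm : PermSymmetric u)
    (hdiv : ∀ x, ∑ i, pd i (fun y => u y i) x = 0)
    (x : V3) (h01 : x 0 = x 1) (h12 : x 1 = x 2) :
    (∀ i j, i ≠ j → pd i (fun y => u y j) x = pd 0 (fun y => u y 1) x) ∧
    (∀ i, pd i (fun y => u y i) x = 0) ∧
    curl u x = 0 := by
  have hd : DifferentiableAt ℝ u x := (hu.differentiable one_ne_zero).differentiableAt
  have ha := pd_apply_perm hd (Equiv.swap 0 1) hperm.swap_zero_one (by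
    ext k
    fin_cases k <;> simp [Equiv.swap_apply_def, h01])
  have hb := pd_apply_perm hd (Equiv.swap 1 2) hperm.swap_one_two (by
    ext k
    fin_cases k <;> simp [Equiv.swap_apply_def, h12])
  have a00 := ha 0 0
  have a02 := ha 0 2
  have a20 := ha 2 0
  have b11 := hb 1 1
  have b12 := hb 1 2
  have b01 := hb 0 1
  have b10 := hb 1 0
  have hsum := hdiv x
  simp [Equiv.swap_apply_def] at a00 a02 a20 b11 b12 b01 b10
  rw [Fin.sum_univ_three] at hsum
  have hoff : ∀ i j, i ≠ j → pd i (fun y => u y j) x = pd 0 (fun y => u y 1) x := by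
    intro i j hij
    fin_cases i <;> fin_cases j <;> simp at hij ⊢ <;> linarith
  refine ⟨hoff, ?_, ?_⟩
  · intro i
    fin_cases i <;> simp <;> linarith
  · ext k
    fin_cases k <;> simp [curl] <;> linarith

end
end
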